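/- (Convergence of MTL-ELM, Lemma 1.) Let (U^k, A^k) be the sequence generated by the MTL-ELM alternating minimization algorithm. Then, as k → ∞, the sequence (U^k, A^k) converges to a stationary point (U*, A*) of the objective J, i.e. a point at which the gradient of J vanishes: ∇J(U*, A*) = 0. -/

import Mathlib

open Matrix Filter Topology

/-- Frobenius inner product `⟨X,Y⟩ = tr(Xᵀ Y)`. -/
noncomputable def finner {α β : Type*} [Fintype α] [Fintype β]
    (X Y : Matrix α β ℝ) : ℝ := (Xᵀ * Y).trace

/-- Squared Frobenius norm `‖X‖² = tr(Xᵀ X)`. -/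
noncomputable def fnormSq {α β : Type*} [Fintype α] [Fintype β]
    (X : Matrix α β ℝ) : ℝ := finner X X

/-- Frobenius norm `‖X‖`. -/
noncomputable def fnorm {α β : Type*} [Fintype α] [Fintype β]
    (X : Matrix α β ℝ) : ℝ := Real.sqrt (fnormSq X)

open IsLocalRing

universe u

theorem exists_dvr_of_isIntegrallyClosed {C : Type*} [CommRing C] [IsDomain C] [IsNoetherianRing C]
    [IsIntegrallyClosed C] {a : C} (ha : a ≠ 0) (hu : ¬ IsUnit a) :
    ∃ (p : Ideal C) (_ : p.IsPrime), a ∈ p ∧ IsDiscreteValuationRing (Localization.AtPrime p) := by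
  obtain ⟨p, hp⟩ := (Ideal.span {a}).nonempty_minimalPrimes (by simpa using hu)
  have hpp : p.IsPrime := hp.1.1
  have hap : a ∈ p := hp.1.2 (Ideal.mem_span_singleton_self a)
  refine ⟨p, hpp, hap, ?_⟩
  have hht := Ideal.height_le_one_of_isPrincipal_of_mem_minimalPrimes _ p hp
  have hic : IsIntegrallyClosed (Localization.AtPrime p) :=
    isIntegrallyClosed_of_isLocalization _ p.primeCompl p.primeCompl_le_nonZeroDivisors
  have hdim : Ring.KrullDimLE 1 (Localization.AtPrime p) := by
    rw [Ring.krullDimLE_iff, IsLocalization.AtPrime.ringKrullDim_eq_height p]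
    exact_mod_cast hht
  have hnf : ¬ IsField (Localization.AtPrime p) := by
    rw [isField_iff_maximalIdeal_eq]
    intro h
    have := (IsLocalization.AtPrime.to_map_mem_maximal_iff (Localization.AtPrime p) p a).mpr hap
    rw [h, Ideal.mem_bot,
      IsLocalization.to_map_eq_zero_iff _ p.primeCompl_le_nonZeroDivisors] at this
    exact ha this
  have huniq : ∀ Q : Ideal (Localization.AtPrime p), Q ≠ ⊥ ∧ Q.IsPrime →
      Q = maximalIdeal (Localization.AtPrime p) := by
    rintro Q ⟨hQ, hQp⟩
    rcases Ring.krullDimLE_one_iff.mp hdim Q hQp with h | h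
    · rw [IsDomain.minimalPrimes_eq_singleton_bot] at h
      exact absurd h hQ
    · exact eq_maximalIdeal h
  exact (((IsDiscreteValuationRing.TFAE (Localization.AtPrime p) hnf).out 0 3 :) :
    IsDiscreteValuationRing (Localization.AtPrime p) ↔
      IsIntegrallyClosed (Localization.AtPrime p) ∧
        ∃! P : Ideal (Localization.AtPrime p), P ≠ ⊥ ∧ P.IsPrime).mpr
    ⟨hic, maximalIdeal _, ⟨isField_iff_maximalIdeal_eq.not.mp hnf, inferInstance⟩, huniq⟩

theorem exists_dvr_of_finiteType (k : Type*) {A : Type u} [Field k] [CharZero k] [CommRing A]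
    [IsDomain A]
    [Algebra k A] [Algebra.FiniteType k A] {a : A} (ha : a ≠ 0) (hu : ¬ IsUnit a) :
    ∃ (W : Type u) (_ : CommRing W) (_ : IsDomain W) (_ : IsDiscreteValuationRing W)
      (φ : A →+* W), φ a ≠ 0 ∧ ¬ IsUnit (φ a) := by
  obtain ⟨s, g, hg, hfin⟩ := exists_finite_inj_algHom_of_fg k A
  let B := MvPolynomial (Fin s) k
  algebraize [g.toRingHom]
  have : FaithfulSMul B A := (faithfulSMul_iff_algebraMap_injective B A).mpr hg
  let K := FractionRing B
  let L := FractionRing A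
  have : Module.Finite B A := hfin
  have : CharZero K := algebraRat.charZero K
  have : FaithfulSMul B L := FaithfulSMul.trans B A L
  let _ : Algebra K L := FractionRing.liftAlgebra B L
  have : IsScalarTower B K L := inferInstance
  have : Algebra.IsIntegral B A := inferInstance
  have : FiniteDimensional K L := .of_isLocalization B A (nonZeroDivisors B)
  have : Algebra.IsSeparable K L := inferInstance
  let C := integralClosure A L
  have : IsScalarTower B C L := IsScalarTower.of_algebraMap_eq fun b => by
    rfl
  have : IsIntegralClosure C B L := 
    { algebraMap_injective := Subtype.val_injective
      isIntegral_iff := fun {x} => 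
        ⟨fun h => ⟨⟨x, h.tower_top⟩, rfl⟩, by
          rintro ⟨y, rfl⟩
          exact isIntegral_trans (A := A) _ y.2⟩ }
  have : IsNoetherianRing C := IsIntegralClosure.isNoetherianRing B K L C
  have : IsIntegrallyClosed C := 
    integralClosure.isIntegrallyClosedOfFiniteExtension (R := A) L
  have hinj : Function.Injective (algebraMap A C) := FaithfulSMul.algebraMap_injective A C
  obtain ⟨p, hp, hap, hW⟩ := exists_dvr_of_isIntegrallyClosed (C := C) (a := algebraMap A C a)
    (by simpa using ha) (fun h => hu (isUnit_of_map_unit _ _ h))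
  refine ⟨Localization.AtPrime p, _, inferInstance, hW,
    (algebraMap C _).comp (algebraMap A C), ?_, ?_⟩
  · rw [RingHom.comp_apply, Ne,
      IsLocalization.to_map_eq_zero_iff _ p.primeCompl_le_nonZeroDivisors]
    simpa using ha
  · rw [RingHom.comp_apply, IsLocalization.AtPrime.isUnit_to_map_iff (Localization.AtPrime p) p]
    simpa using hap

theorem Algebra.FormallySmooth.of_charZero (k K : Type*) [Field k] [CharZero k] [Field K]
    [Algebra k K] :
    Algebra.FormallySmooth k K := by
  obtain ⟨s, hs⟩ := exists_isTranscendenceBasis k K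
  have hK : CharZero (IntermediateField.adjoin k (Set.range ((↑) : s → K))) := algebraRat.charZero _
  have := hs.isAlgebraic_field
  exact .of_algebraicIndependent_of_isSeparable hs.1

theorem MvPolynomial.derivative_aeval {k K σ : Type*} [Fintype σ] [CommRing k] [CommRing K]
    [Algebra k K] (p : σ → Polynomial K) (f : MvPolynomial σ k) :
    Polynomial.derivative (aeval p f) =
      ∑ i, aeval p (pderiv i f) * Polynomial.derivative (p i) := by
  classical
  induction f using MvPolynomial.induction_on with
  | C a => simp [Polynomial.algebraMap_apply]
  | add f g hf hg => simp [hf, hg, add_mul, Finset.sum_add_distrib]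
  | mul_X f j hf =>
    have h : ∀ i, aeval p (pderiv i (f * X j)) * Polynomial.derivative (p i) =
        aeval p (pderiv i f) * Polynomial.derivative (p i) * p j +
          if i = j then aeval p f * Polynomial.derivative (p j) else 0 := by
      intro i
      rw [Derivation.leibniz, pderiv_X, Pi.single_apply]
      by_cases hij : i = j
      · subst hij
        simp only [if_true, smul_eq_mul, mul_one, map_add, map_mul, aeval_X]
        ring
      · simp only [hij, Ne.symm hij, if_false, smul_eq_mul, mul_zero, zero_add, add_zero, map_mul,
          aeval_X]
        ring
    rw [Finset.sum_congr rfl fun i _ => h i, Finset.sum_add_distrib, Finset.sum_ite_eq',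
      if_pos (Finset.mem_univ j), ← Finset.sum_mul, ← hf, map_mul, aeval_X,
      Polynomial.derivative_mul]

/-- A discrete valuation ring over a field of characteristic zero is, modulo a power of its maximal
ideal, a quotient of a polynomial ring over its residue field, compatibly with valuations. -/
theorem exists_truncation (k : Type*) {W : Type*} [Field k] [CharZero k] [CommRing W] [IsDomain W]
    [IsDiscreteValuationRing W] [Algebra k W] {ϖ : W} (hϖ : Irreducible ϖ) {n : ℕ} (hn : 0 < n) :
    ∃ ψ : Polynomial (ResidueField W) →ₐ[k] W ⧸ Ideal.span {ϖ ^ n},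
      Function.Surjective ψ ∧ ψ Polynomial.X = Ideal.Quotient.mk _ ϖ ∧
      ∀ j ≤ n, ∀ P w, ψ P = Ideal.Quotient.mk _ w → ϖ ^ j ∣ w → Polynomial.X ^ j ∣ P := by
  have := Algebra.FormallySmooth.of_charZero k (ResidueField W)
  set I : Ideal W := Ideal.span {ϖ ^ n} with hI
  have hIm : I ≤ maximalIdeal W := by
    rw [hI, Ideal.span_singleton_le_iff_mem, hϖ.maximalIdeal_eq]
    exact Ideal.mem_span_singleton.mpr (dvd_pow_self _ hn.ne')
  let g : W ⧸ I →ₐ[k] ResidueField W := Ideal.Quotient.factorₐ k hIm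
  have hgmk : ∀ w, g (Ideal.Quotient.mk I w) = residue W w := fun w => rfl
  have hg : Function.Surjective g := fun c => by
    obtain ⟨w, rfl⟩ := residue_surjective c
    exact ⟨_, hgmk w⟩
  have hker : ∀ q, g q = 0 → ∃ b, q = Ideal.Quotient.mk I ϖ * b := by
    intro q hq
    obtain ⟨w, rfl⟩ := Ideal.Quotient.mk_surjective q
    rw [hgmk, residue_eq_zero_iff, hϖ.maximalIdeal_eq, Ideal.mem_span_singleton] at hq
    obtain ⟨b, rfl⟩ := hq
    exact ⟨Ideal.Quotient.mk I b, map_mul _ _ _⟩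
  have htn : Ideal.Quotient.mk I ϖ ^ n = 0 := by
    rw [← map_pow, Ideal.Quotient.eq_zero_iff_mem]
    exact Ideal.mem_span_singleton_self _
  have hnil : IsNilpotent (RingHom.ker (g : W ⧸ I →+* ResidueField W)) := by
    refine ⟨n, ?_⟩
    have hle : RingHom.ker (g : W ⧸ I →+* ResidueField W) ≤ Ideal.span {Ideal.Quotient.mk I ϖ} := by
      intro q hq
      obtain ⟨b, rfl⟩ := hker q hq
      exact Ideal.mem_span_singleton.mpr (dvd_mul_right _ _)
    have := Ideal.pow_right_mono hle n
    rw [Ideal.span_singleton_pow, htn] at this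
    simpa using this
  let τ := Algebra.FormallySmooth.liftOfSurjective (AlgHom.id k (ResidueField W)) g hg hnil
  have hτ : ∀ c, g (τ c) = c := fun c =>
    Algebra.FormallySmooth.liftOfSurjective_apply (AlgHom.id k (ResidueField W)) g hg hnil c
  let ψ : Polynomial (ResidueField W) →ₐ[k] W ⧸ I :=
    { Polynomial.eval₂RingHom (τ : ResidueField W →+* W ⧸ I) (Ideal.Quotient.mk I ϖ) with
      commutes' := fun c => by
        simp [Polynomial.algebraMap_apply] }
  have hψ : ∀ P, ψ P = Polynomial.eval₂ (τ : ResidueField W →+* W ⧸ I) (Ideal.Quotient.mk I ϖ) P :=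
    fun P => rfl
  have hψX : ψ Polynomial.X = Ideal.Quotient.mk I ϖ := by simp [hψ]
  have hψC : ∀ c, ψ (Polynomial.C c) = τ c := by simp [hψ]
  have hgψ : ∀ P, g (ψ P) = P.coeff 0 := by
    intro P
    have h : g (Ideal.Quotient.mk I ϖ) = 0 := by
      rw [hgmk, residue_eq_zero_iff, hϖ.maximalIdeal_eq]
      exact Ideal.mem_span_singleton_self _
    conv_lhs => rw [← Polynomial.divX_mul_X_add P]
    rw [map_add, map_mul, hψX, hψC, map_add, map_mul, h, mul_zero, zero_add, hτ]
  refine ⟨ψ, ?_, hψX, ?_⟩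
  · have key : ∀ j : ℕ, ∀ q, ∃ P b, q = ψ P + Ideal.Quotient.mk I ϖ ^ j * b := by
      intro j q
      induction j with
      | zero => exact ⟨0, q, by simp⟩
      | succ j ih =>
        obtain ⟨P, b, rfl⟩ := ih
        obtain ⟨c, hc⟩ := hker (b - τ (g b)) (by rw [map_sub, hτ, sub_self])
        refine ⟨P + Polynomial.C (g b) * Polynomial.X ^ j, c, ?_⟩
        rw [map_add, map_mul, map_pow, hψX, hψC]
        linear_combination Ideal.Quotient.mk I ϖ ^ j * hc
    intro q
    obtain ⟨P, b, h⟩ := key n q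
    exact ⟨P, by rw [h, htn, zero_mul, add_zero]⟩
  · intro j
    induction j with
    | zero => simp
    | succ j ih =>
      intro hj P w hw hdvd
      obtain ⟨R, rfl⟩ := ih (by omega) P w hw ((pow_dvd_pow _ (by omega)).trans hdvd)
      rw [pow_succ]
      refine mul_dvd_mul_left _ (Polynomial.X_dvd_iff.mpr ?_)
      obtain ⟨v, hv⟩ := Ideal.Quotient.mk_surjective (ψ R)
      rw [map_mul, map_pow, hψX, ← hv, ← map_pow, ← map_mul, Ideal.Quotient.eq,
        Ideal.mem_span_singleton] at hw
      have h1 : ϖ ^ (j + 1) ∣ ϖ ^ j * v := by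
        have := dvd_add ((pow_dvd_pow ϖ hj).trans hw) hdvd
        simpa using this
      rw [pow_succ, mul_dvd_mul_iff_left (pow_ne_zero _ hϖ.ne_zero)] at h1
      rw [← hgψ, ← hv, hgmk, residue_eq_zero_iff, hϖ.maximalIdeal_eq, Ideal.mem_span_singleton]
      exact h1

theorem not_forall_dvd_pderiv {k W σ : Type*} [Finite σ] [Field k] [CharZero k] [CommRing W]
    [IsDomain W]
    [IsDiscreteValuationRing W] [Algebra k W] (f : MvPolynomial σ k) (a : σ → W)
    (h0 : MvPolynomial.aeval a f ≠ 0) (hu : ¬ IsUnit (MvPolynomial.aeval a f)) :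
    ¬ ∀ i, MvPolynomial.aeval a f ∣ MvPolynomial.aeval a (MvPolynomial.pderiv i f) := by
  intro hdvd
  have := Fintype.ofFinite σ
  obtain ⟨ϖ, hϖ⟩ := IsDiscreteValuationRing.exists_irreducible W
  obtain ⟨n, hn⟩ := IsDiscreteValuationRing.associated_pow_irreducible h0 hϖ
  have hn0 : n ≠ 0 := by
    rintro rfl
    exact hu (by simpa using hn)
  obtain ⟨ψ, hs, hX, hψ⟩ := exists_truncation k hϖ n.succ_pos
  choose p hp using fun i => hs (Ideal.Quotient.mk _ (a i))
  have hev : ∀ h : MvPolynomial σ k, ψ (MvPolynomial.aeval p h) =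
      Ideal.Quotient.mk _ (MvPolynomial.aeval a h) := by
    intro h
    rw [← AlgHom.comp_apply, MvPolynomial.comp_aeval]
    simp only [hp]
    exact (DFunLike.congr_fun (MvPolynomial.comp_aeval a (Ideal.Quotient.mkₐ k _)) h).symm
  obtain ⟨R, hR⟩ := hψ n (by omega) _ _ (hev f) hn.symm.dvd
  have hder : Polynomial.X ^ n ∣ Polynomial.derivative (MvPolynomial.aeval p f) := by
    rw [MvPolynomial.derivative_aeval]
    exact Finset.dvd_sum fun i _ => Dvd.dvd.mul_right
      (hψ n (by omega) _ _ (hev _) (hn.symm.dvd.trans (hdvd i))) _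
  have hR0 : Polynomial.X ∣ R := by
    obtain ⟨n, rfl⟩ := Nat.exists_eq_succ_of_ne_zero hn0
    rw [hR, Polynomial.derivative_mul, Polynomial.derivative_X_pow] at hder
    replace hder := (dvd_add_left (dvd_mul_right _ _)).mp hder
    rw [Nat.succ_eq_add_one, Nat.add_sub_cancel, pow_succ, mul_assoc, mul_left_comm,
      mul_dvd_mul_iff_left (pow_ne_zero _ Polynomial.X_ne_zero), Polynomial.X_dvd_iff,
      Polynomial.coeff_C_mul] at hder
    have : CharZero (ResidueField W) :=
      charZero_of_injective_algebraMap (algebraMap k _).injective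
    rw [Polynomial.X_dvd_iff]
    exact (mul_eq_zero.mp hder).resolve_left (by exact_mod_cast n.succ_ne_zero)
  obtain ⟨S, rfl⟩ := hR0
  have h1 := hev f
  rw [hR, ← mul_assoc, ← pow_succ, map_mul, map_pow, hX, ← map_pow,
    Ideal.Quotient.eq_zero_iff_mem.mpr (Ideal.mem_span_singleton_self _), zero_mul, eq_comm,
    Ideal.Quotient.eq_zero_iff_mem, Ideal.mem_span_singleton] at h1
  have h2 := h1.trans hn.dvd
  rw [pow_dvd_pow_iff hϖ.ne_zero hϖ.not_isUnit] at h2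
  omega

/-- A nonzero polynomial `f` is a unit in the algebra generated by the coordinates and the
logarithmic derivatives `∂ᵢ f / f`. -/
theorem exists_eval_mul_eval_eq_one {k σ : Type*} [Finite σ] [Field k] [CharZero k]
    {f : MvPolynomial σ k} (hf : f ≠ 0) :
    ∃ q : MvPolynomial (σ ⊕ σ) k, ∀ x : σ → k, MvPolynomial.eval x f ≠ 0 →
      MvPolynomial.eval x f * MvPolynomial.eval (Sum.elim x fun i =>
        MvPolynomial.eval x (MvPolynomial.pderiv i f) / MvPolynomial.eval x f) q = 1 := by
  let S := Localization.Away f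
  have : IsDomain S :=
    IsLocalization.isDomain_localization (powers_le_nonZeroDivisors_of_noZeroDivisors hf)
  have hinj : Function.Injective (algebraMap (MvPolynomial σ k) S) :=
    IsLocalization.injective S (powers_le_nonZeroDivisors_of_noZeroDivisors hf)
  let v : σ ⊕ σ → S := Sum.elim
    (fun i => algebraMap (MvPolynomial σ k) S (MvPolynomial.X i)) fun i =>
    algebraMap _ S (MvPolynomial.pderiv i f) * IsLocalization.Away.invSelf f
  let φ : MvPolynomial (σ ⊕ σ) k →ₐ[k] S := MvPolynomial.aeval v
  have hφl : ∀ h : MvPolynomial σ k, φ (MvPolynomial.rename Sum.inl h) = algebraMap _ S h := by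
    intro h
    rw [MvPolynomial.aeval_rename]
    exact (DFunLike.congr_fun (MvPolynomial.comp_aeval MvPolynomial.X
      (IsScalarTower.toAlgHom k (MvPolynomial σ k) S)) h).symm.trans (by simp)
  let ρ : MvPolynomial (σ ⊕ σ) k →ₐ[k] φ.range := φ.rangeRestrict
  have hρs : Function.Surjective ρ := φ.rangeRestrict_surjective
  have hρ : ∀ q, (ρ q : S) = φ q := fun q => rfl
  have : Algebra.FiniteType k φ.range := Algebra.FiniteType.of_surjective ρ hρs
  have hfu : IsUnit (ρ (MvPolynomial.rename Sum.inl f)) := by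
    by_contra hu
    have h0 : ρ (MvPolynomial.rename Sum.inl f) ≠ 0 := by
      intro h
      have := congrArg Subtype.val h
      rw [hρ, hφl] at this
      exact hf (hinj (by simpa using this))
    obtain ⟨W, _, _, _, g, hg0, hgu⟩ := exists_dvr_of_finiteType k h0 hu
    let _ : Algebra k W := (g.comp (algebraMap k φ.range)).toAlgebra
    let gk : φ.range →ₐ[k] W := { g with commutes' := fun c => rfl }
    have hev : ∀ h : MvPolynomial σ k, MvPolynomial.aeval
        (fun i => g (ρ (MvPolynomial.X (Sum.inl i)))) h =
          g (ρ (MvPolynomial.rename Sum.inl h)) := by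
      intro h
      have := MvPolynomial.algHom_ext (f := MvPolynomial.aeval
        (fun i => g (ρ (MvPolynomial.X (Sum.inl i)))))
        (g := (gk.comp ρ).comp (MvPolynomial.rename Sum.inl)) (fun i => by simp [gk])
      exact DFunLike.congr_fun this h
    refine not_forall_dvd_pderiv f (fun i => g (ρ (MvPolynomial.X (Sum.inl i))))
      (by rwa [hev]) (by rwa [hev]) fun i => ?_
    rw [hev, hev]
    refine map_dvd g ⟨ρ (MvPolynomial.X (Sum.inr i)), Subtype.ext ?_⟩
    rw [MulMemClass.coe_mul, hρ, hρ, hρ, hφl, hφl, MvPolynomial.aeval_X]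
    simp only [v, Sum.elim_inr]
    rw [mul_left_comm, IsLocalization.Away.mul_invSelf, mul_one]
  obtain ⟨b, hb⟩ := hfu.exists_right_inv
  obtain ⟨q, rfl⟩ := hρs b
  refine ⟨q, fun x hx => ?_⟩
  let e : S →+* k := IsLocalization.Away.lift f (g := MvPolynomial.eval x)
    (isUnit_iff_ne_zero.mpr hx)
  have he : ∀ h, e (algebraMap _ S h) = MvPolynomial.eval x h :=
    fun h => IsLocalization.Away.lift_eq f _ h
  have hinv : e (IsLocalization.Away.invSelf f) = (MvPolynomial.eval x f)⁻¹ := by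
    refine eq_inv_of_mul_eq_one_right ?_
    rw [← he, ← map_mul, IsLocalization.Away.mul_invSelf, map_one]
  have hq : e (φ q) = MvPolynomial.eval (Sum.elim x fun i =>
      MvPolynomial.eval x (MvPolynomial.pderiv i f) / MvPolynomial.eval x f) q := by
    have := MvPolynomial.ringHom_ext (f := e.comp φ) (g := MvPolynomial.eval (Sum.elim x fun i =>
      MvPolynomial.eval x (MvPolynomial.pderiv i f) / MvPolynomial.eval x f))
      (fun c => by
        have hc : φ (MvPolynomial.C c) = algebraMap _ S (MvPolynomial.C c) :=
          (φ.commutes c).trans (IsScalarTower.algebraMap_apply k (MvPolynomial σ k) S c)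
        rw [RingHom.comp_apply, RingHom.coe_coe, hc, he, MvPolynomial.eval_C, MvPolynomial.eval_C])
      (fun i => by
        rcases i with i | i
        · simp [φ, v, he]
        · simp [φ, v, he, hinv, div_eq_mul_inv])
    exact DFunLike.congr_fun this q
  have h1 := congrArg (fun z : φ.range => e z) hb
  simp only [MulMemClass.coe_mul, hρ, hφl, map_mul, he, hq, OneMemClass.coe_one, map_one] at h1
  exact h1

theorem MvPolynomial.exists_abs_eval_le {σ : Type*} (q : MvPolynomial σ ℝ) :
    ∃ C > 0, ∃ M : ℕ, ∀ B ≥ 1, ∀ z : σ → ℝ, (∀ i, |z i| ≤ B) → |eval z q| ≤ C * B ^ M := by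
  induction q using MvPolynomial.induction_on with
  | C a => exact ⟨|a| + 1, by positivity, 0, fun B _ z _ => by simp⟩
  | add p q hp hq =>
    obtain ⟨C, hC, M, h⟩ := hp
    obtain ⟨D, hD, N, h'⟩ := hq
    refine ⟨C + D, by positivity, max M N, fun B hB z hz => ?_⟩
    rw [map_add, add_mul]
    refine (abs_add_le _ _).trans (add_le_add ((h B hB z hz).trans ?_) ((h' B hB z hz).trans ?_))
    · gcongr
      exact le_max_left _ _
    · gcongr
      exact le_max_right _ _
  | mul_X p i hp =>
    obtain ⟨C, hC, M, h⟩ := hp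
    refine ⟨C, hC, M + 1, fun B hB z hz => ?_⟩
    rw [map_mul, eval_X, abs_mul, pow_succ, ← mul_assoc]
    exact mul_le_mul (h B hB z hz) (hz i) (abs_nonneg _) (by positivity)

theorem MvPolynomial.exists_abs_eval_sub_le {σ : Type*} (q : MvPolynomial σ ℝ) (R : ℝ) :
    ∃ K ≥ 0, ∀ (y z : σ → ℝ) (d : ℝ), (∀ i, |y i| ≤ R) → (∀ i, |z i| ≤ R) → 0 ≤ d →
      (∀ i, |y i - z i| ≤ d) → |eval y q - eval z q| ≤ K * d := by
  induction q using MvPolynomial.induction_on with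
  | C a => exact ⟨0, le_rfl, fun y z d _ _ _ _ => by simp⟩
  | add p q hp hq =>
    obtain ⟨C, hC, h⟩ := hp
    obtain ⟨D, hD, h'⟩ := hq
    refine ⟨C + D, by positivity, fun y z d hy hz hd hyz => ?_⟩
    rw [map_add, map_add, add_mul, add_sub_add_comm]
    exact (abs_add_le _ _).trans (add_le_add (h y z d hy hz hd hyz) (h' y z d hy hz hd hyz))
  | mul_X p i hp =>
    obtain ⟨C, hC, h⟩ := hp
    obtain ⟨D, hD, M, h'⟩ := p.exists_abs_eval_le
    refine ⟨C * max R 1 + D * max R 1 ^ M, by positivity, fun y z d hy hz hd hyz => ?_⟩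
    rw [map_mul, map_mul, eval_X, eval_X]
    have e : eval y p * y i - eval z p * z i =
      (eval y p - eval z p) * y i + eval z p * (y i - z i) := by ring
    rw [e, add_mul]
    refine (abs_add_le _ _).trans (add_le_add ?_ ?_)
    · rw [abs_mul, mul_right_comm]
      exact mul_le_mul (h y z d hy hz hd hyz) ((hy i).trans (le_max_left _ _)) (abs_nonneg _)
        (by positivity)
    · rw [abs_mul]
      exact mul_le_mul (h' _ (le_max_right _ _) z fun i => (hz i).trans (le_max_left _ _)) (hyz i)
        (abs_nonneg _) (by positivity)

theorem MvPolynomial.hasDerivAt_eval_update {σ : Type*} [DecidableEq σ] (p : MvPolynomial σ ℝ)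
    (x : σ → ℝ) (i : σ) :
    HasDerivAt (fun s => eval (Function.update x i s) p) (eval x (pderiv i p)) (x i) := by
  induction p using MvPolynomial.induction_on with
  | C a => simpa using hasDerivAt_const (x i) a
  | add p q hp hq =>
    simp only [map_add]
    exact hp.fun_add hq
  | mul_X p j hp =>
    have hj : HasDerivAt (fun s => Function.update x i s j) (if j = i then 1 else 0) (x i) := by
      by_cases h : j = i
      · subst h
        simpa only [Function.update_self, if_true] using hasDerivAt_id' (x j)
      · simpa [h] using hasDerivAt_const (x i) (x j)
    have h := hp.fun_mul hj
    simp only [Function.update_eq_self] at h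
    have e : eval x (pderiv i (p * X j)) =
        eval x (pderiv i p) * x j + eval x p * (if j = i then 1 else 0) := by
      rw [Derivation.leibniz, pderiv_X, Pi.single_apply]
      by_cases hij : i = j
      · subst hij
        simp [add_comm, mul_comm]
      · simp [Ne.symm hij, mul_comm]
    rw [e]
    simp only [map_mul, eval_X]
    exact h

/-- The Łojasiewicz gradient inequality. -/
theorem MvPolynomial.lojasiewicz_gradient {σ : Type*} [Finite σ] (f : MvPolynomial σ ℝ) (R : ℝ) :
    ∃ M : ℕ, ∃ C > 0, ∃ δ > 0, ∀ (x : σ → ℝ) (G : ℝ), (∀ i, |x i| ≤ R) → |eval x f| ≤ δ → 0 ≤ G →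
      (∀ i, |eval x (pderiv i f)| ≤ G) → |eval x f| ^ (M + 1) ≤ C * G ^ (M + 2) := by
  by_cases hf : f = 0
  · refine ⟨0, 1, one_pos, 1, one_pos, fun x G _ _ hG _ => ?_⟩
    simpa [hf] using pow_nonneg hG 2
  obtain ⟨q, hq⟩ := exists_eval_mul_eval_eq_one hf
  obtain ⟨C, hC, M, hM⟩ := q.exists_abs_eval_le
  set B := max R 1 with hB
  have hB1 : 1 ≤ B := le_max_right _ _
  refine ⟨M, C, hC, 1 / (2 * C * B ^ (M + 2)), by positivity, fun x G hx hδ hG hGx => ?_⟩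
  by_cases h0 : eval x f = 0
  · rw [h0, abs_zero, zero_pow M.succ_ne_zero]
    exact mul_nonneg hC.le (pow_nonneg hG _)
  set s := |eval x f| with hs
  have hs0 : 0 < s := abs_pos.mpr h0
  have hbound := hM (max B (G / s)) (hB1.trans (le_max_left _ _))
    (Sum.elim x fun i => eval x (pderiv i f) / eval x f) (by
      rintro (i | i)
      · exact (hx i).trans ((le_max_left _ _).trans (le_max_left _ _))
      · refine le_trans ?_ (le_max_right _ _)
        rw [Sum.elim_inr, abs_div]
        exact div_le_div_of_nonneg_right (hGx i) hs0.le)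
  have hone : 1 ≤ s * (C * max B (G / s) ^ (M + 2)) := by
    have h1 := congrArg abs (hq x h0)
    rw [abs_mul, abs_one] at h1
    rw [← h1]
    refine mul_le_mul_of_nonneg_left (hbound.trans ?_) hs0.le
    gcongr
    · exact hB1.trans (le_max_left _ _)
    · omega
  rcases max_choice B (G / s) with h | h
  · rw [h] at hone
    have : s * (C * B ^ (M + 2)) ≤ 1 / (2 * C * B ^ (M + 2)) * (C * B ^ (M + 2)) :=
      mul_le_mul_of_nonneg_right hδ (by positivity)
    have e : 1 / (2 * C * B ^ (M + 2)) * (C * B ^ (M + 2)) = 1 / 2 := by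
      field_simp
    linarith
  · rw [h, div_pow] at hone
    have e : s * (C * (G ^ (M + 2) / s ^ (M + 2))) * s ^ (M + 1) = C * G ^ (M + 2) := by
      field_simp
      ring
    rw [← e]
    exact le_mul_of_one_le_left (by positivity) hone

theorem summable_of_sq_le_sub_of_pow_le {Δ d : ℕ → ℝ} {c C : ℝ} {M : ℕ} (hc : 0 < c) (hC : 0 < C)
    (hΔ : ∀ k, 0 ≤ Δ k) (hd : ∀ k, 0 ≤ d k) (hdec : ∀ k, c * d k ^ 2 ≤ Δ k - Δ (k + 1))
    (hL : ∀ k, Δ (k + 1) ^ (M + 1) ≤ C * d k ^ (M + 2)) : Summable d := by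
  have hroot : ∀ a : ℝ, 0 ≤ a → ∃ b, 0 ≤ b ∧ b ^ (M + 2) = a := fun a ha =>
    ⟨a ^ ((M + 2 : ℕ) : ℝ)⁻¹, by positivity, Real.rpow_inv_natCast_pow ha (by omega)⟩
  choose e he0 he using fun k => hroot (Δ k) (hΔ k)
  obtain ⟨D, hD0, hD⟩ := hroot C hC.le
  have hD' : ∀ k, e (k + 1) ^ (M + 1) ≤ D * d k := by
    intro k
    refine (pow_le_pow_iff_left₀ (by have := he0 (k + 1); positivity) (mul_nonneg hD0 (hd k))
      (show M + 2 ≠ 0 by omega)).mp ?_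
    rw [← pow_mul, mul_comm (M + 1), pow_mul, he, mul_pow, hD]
    exact hL k
  have hmono : ∀ k, e (k + 1) ≤ e k := fun k => by
    refine (pow_le_pow_iff_left₀ (he0 _) (he0 k) (show M + 2 ≠ 0 by omega)).mp ?_
    rw [he, he]
    nlinarith [hdec k, sq_nonneg (d k)]
  have hpow : ∀ a b : ℝ, 0 ≤ b → b ≤ a →
      a ^ (M + 2) - b ^ (M + 2) ≤ (M + 2) * a ^ (M + 1) * (a - b) := by
    intro a b hb hab
    rw [← geom_sum₂_mul a b]
    refine mul_le_mul_of_nonneg_right ?_ (sub_nonneg.mpr hab)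
    have hle : ∀ i ∈ Finset.range (M + 2), a ^ i * b ^ (M + 2 - 1 - i) ≤ a ^ (M + 1) := by
      intro i hi
      rw [Finset.mem_range] at hi
      calc a ^ i * b ^ (M + 2 - 1 - i) ≤ a ^ i * a ^ (M + 2 - 1 - i) := by
            have := hb.trans hab
            gcongr
        _ = a ^ (M + 1) := by rw [← pow_add]; congr 1; omega
    refine (Finset.sum_le_card_nsmul _ _ _ hle).trans (le_of_eq ?_)
    rw [Finset.card_range, nsmul_eq_mul]
    push_cast
    ring
  set Q := (M + 2) * D / c with hQ
  have hstep : ∀ k, d k / 2 ≤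
      (d k + Q / 2 * e (k + 1)) - (d (k + 1) + Q / 2 * e (k + 1 + 1)) := by
    intro k
    have h1 := hdec (k + 1)
    rw [← he, ← he] at h1
    have h2 := hpow _ _ (he0 (k + 1 + 1)) (hmono (k + 1))
    have h3 : (M + 2) * e (k + 1) ^ (M + 1) * (e (k + 1) - e (k + 1 + 1)) ≤
        (M + 2) * (D * d k) * (e (k + 1) - e (k + 1 + 1)) := by
      have := hD' k
      have := sub_nonneg.mpr (hmono (k + 1))
      gcongr
    have h4 : d (k + 1) ^ 2 ≤ d k * (Q * (e (k + 1) - e (k + 1 + 1))) := by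
      rw [hQ, show d k * ((M + 2) * D / c * (e (k + 1) - e (k + 1 + 1))) =
        ((M + 2) * (D * d k) * (e (k + 1) - e (k + 1 + 1))) / c by ring, le_div_iff₀ hc]
      linarith
    have hQ0 : 0 ≤ Q * (e (k + 1) - e (k + 1 + 1)) :=
      mul_nonneg (by positivity) (sub_nonneg.mpr (hmono (k + 1)))
    have h5 : d (k + 1) ≤ (d k + Q * (e (k + 1) - e (k + 1 + 1))) / 2 := by
      refine abs_le_of_sq_le_sq' ?_ (by have := hd k; positivity) |>.2
      nlinarith [sq_nonneg (d k - Q * (e (k + 1) - e (k + 1 + 1)))]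
    linarith
  refine summable_of_sum_range_le (c := 2 * (d 0 + Q / 2 * e 1)) hd fun n => ?_
  have hsum : ∑ k ∈ Finset.range n, d k / 2 ≤
      (d 0 + Q / 2 * e 1) - (d n + Q / 2 * e (n + 1)) := by
    rw [← Finset.sum_range_sub' (fun k => d k + Q / 2 * e (k + 1))]
    exact Finset.sum_le_sum fun k _ => hstep k
  rw [← Finset.sum_div] at hsum
  have : 0 ≤ d n + Q / 2 * e (n + 1) := by
    have := hd n
    have := he0 (n + 1)
    positivity
  linarith

/-- A descent sequence for a polynomial that satisfies a relative error condition of alternating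
minimization type converges. -/
theorem MvPolynomial.exists_tendsto_of_descent {σ : Type*} [Finite σ] (f : MvPolynomial σ ℝ)
    {z w : ℕ → σ → ℝ} {D : ℕ → ℝ} {c R : ℝ} (hc : 0 < c) (hz : ∀ k i, |z k i| ≤ R)
    (hw : ∀ k i, |w k i| ≤ R) (hD : ∀ k, 0 ≤ D k) (hzz : ∀ k i, |z (k + 1) i - z k i| ≤ D k)
    (hzw : ∀ k i, |z (k + 1) i - w k i| ≤ D k)
    (hcrit : ∀ k i, eval (w k) (pderiv i f) = 0 ∨ eval (z (k + 1)) (pderiv i f) = 0)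
    (hdec : ∀ k, c * D k ^ 2 ≤ eval (z k) f - eval (z (k + 1)) f)
    (hbdd : ∀ k, 0 ≤ eval (z k) f) : ∃ x, Tendsto z atTop (𝓝 x) := by
  have := Fintype.ofFinite σ
  have hanti : Antitone fun k => eval (z k) f :=
    antitone_nat_of_succ_le fun k => by
      have := hdec k
      have := mul_nonneg hc.le (sq_nonneg (D k))
      linarith
  have hbelow : BddBelow (Set.range fun k => eval (z k) f) :=
    ⟨0, by rintro _ ⟨k, rfl⟩; exact hbdd k⟩
  set l := ⨅ k, eval (z k) f with hl
  have hlim : Tendsto (fun k => eval (z k) f) atTop (𝓝 l) := tendsto_atTop_ciInf hanti hbelow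
  have hle : ∀ k, l ≤ eval (z k) f := fun k => ciInf_le hbelow k
  choose K hK0 hK using fun i => (pderiv i f).exists_abs_eval_sub_le R
  have hgrad : ∀ k i, |eval (z (k + 1)) (pderiv i f)| ≤ (∑ j, K j) * D k := by
    intro k i
    rcases hcrit k i with h | h
    · have h1 := hK i (z (k + 1)) (w k) (D k) (hz _) (hw _) (hD k) (hzw k)
      rw [h, sub_zero] at h1
      exact h1.trans (mul_le_mul_of_nonneg_right
        (Finset.single_le_sum (fun j _ => hK0 j) (Finset.mem_univ i)) (hD k))
    · rw [h, abs_zero]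
      exact mul_nonneg (Finset.sum_nonneg fun j _ => hK0 j) (hD k)
  obtain ⟨M, C, hC, δ, hδ, hloj⟩ := (f - C l).lojasiewicz_gradient R
  obtain ⟨N, hN⟩ := (hlim.eventually_le_const (show l < l + δ by linarith)).exists_forall_of_atTop
  set K' := ∑ j, K j
  have hK' : 0 ≤ K' := Finset.sum_nonneg fun j _ => hK0 j
  have hsum : Summable D := by
    rw [← summable_nat_add_iff N]
    refine summable_of_sq_le_sub_of_pow_le (c := c) (C := C * (K' + 1) ^ (M + 2)) (M := M)
      (Δ := fun k => eval (z (k + N)) f - l) hc (by positivity)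
      (fun k => sub_nonneg.2 (hle _)) (fun k => hD _) (fun k => ?_) fun k => ?_
    · have := hdec (k + N)
      rw [show k + 1 + N = k + N + 1 by ring]
      linarith
    · rw [show k + 1 + N = k + N + 1 by ring]
      have h0 := sub_nonneg.2 (hle (k + N + 1))
      have h1 := hloj (z (k + N + 1)) ((K' + 1) * D (k + N)) (hz _)
        (by
          rw [map_sub, eval_C, abs_of_nonneg h0]
          linarith [hN (k + N + 1) (by omega)])
        (mul_nonneg (by linarith) (hD _))
        (fun i => by
          rw [map_sub, pderiv_C, sub_zero]
          exact (hgrad _ i).trans (mul_le_mul_of_nonneg_right (by linarith) (hD _)))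
      rwa [map_sub, eval_C, abs_of_nonneg h0, mul_pow, ← mul_assoc] at h1
  have hcau : ∀ i, ∃ a, Tendsto (fun k => z k i) atTop (𝓝 a) := fun i =>
    cauchySeq_tendsto_of_complete (cauchySeq_of_dist_le_of_summable D
      (fun k => by rw [dist_comm, Real.dist_eq]; exact hzz k i) hsum)
  choose x hx using hcau
  exact ⟨x, tendsto_pi_nhds.2 hx⟩

theorem MvPolynomial.eval_pderiv_eq_zero_of_forall_le {σ : Type*} [DecidableEq σ]
    {p : MvPolynomial σ ℝ} {x : σ → ℝ} {i : σ}
    (h : ∀ s, eval x p ≤ eval (Function.update x i s) p) : eval x (pderiv i p) = 0 :=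
  IsLocalMin.hasDerivAt_eq_zero (Eventually.of_forall fun s => by
    simpa only [Function.update_eq_self] using h s) (p.hasDerivAt_eval_update x i)

section Frobenius

variable {α β γ δ : Type*} [Fintype α] [Fintype β] [Fintype γ] [Fintype δ]

theorem finner_eq_sum (X Y : Matrix α β ℝ) : finner X Y = ∑ i, ∑ j, X i j * Y i j := by
  simp only [finner, Matrix.trace, Matrix.diag, Matrix.mul_apply, Matrix.transpose_apply]
  exact Finset.sum_comm

theorem fnormSq_eq_sum (X : Matrix α β ℝ) : fnormSq X = ∑ i, ∑ j, X i j ^ 2 := by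
  simp only [fnormSq, finner_eq_sum, sq]

theorem fnormSq_nonneg (X : Matrix α β ℝ) : 0 ≤ fnormSq X := by
  rw [fnormSq_eq_sum]
  positivity

theorem sq_apply_le_fnormSq (X : Matrix α β ℝ) (i : α) (j : β) : X i j ^ 2 ≤ fnormSq X := by
  rw [fnormSq_eq_sum]
  refine le_trans ?_ (Finset.single_le_sum (f := fun i => ∑ j, X i j ^ 2)
    (fun i _ => Finset.sum_nonneg fun j _ => sq_nonneg _) (Finset.mem_univ i))
  exact Finset.single_le_sum (f := fun j => X i j ^ 2) (fun j _ => sq_nonneg _) (Finset.mem_univ j)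

theorem eq_zero_of_fnormSq_eq_zero {X : Matrix α β ℝ} (h : fnormSq X = 0) : X = 0 := by
  ext i j
  have := sq_apply_le_fnormSq X i j
  rw [h] at this
  exact pow_eq_zero_iff two_ne_zero |>.mp (le_antisymm this (sq_nonneg _))

theorem finner_add_left (X Y Z : Matrix α β ℝ) : finner (X + Y) Z = finner X Z + finner Y Z := by
  simp [finner, Matrix.add_mul]

theorem finner_smul_left (c : ℝ) (X Z : Matrix α β ℝ) : finner (c • X) Z = c * finner X Z := by
  simp [finner]

theorem finner_smul_right (c : ℝ) (X Z : Matrix α β ℝ) : finner X (c • Z) = c * finner X Z := by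
  simp [finner]

theorem finner_zero_left (X : Matrix α β ℝ) : finner 0 X = 0 := by
  simp [finner]

theorem finner_sum_left {ι : Type*} (s : Finset ι) (X : ι → Matrix α β ℝ) (Z : Matrix α β ℝ) :
    finner (∑ t ∈ s, X t) Z = ∑ t ∈ s, finner (X t) Z := by
  simp [finner, Matrix.transpose_sum, Matrix.sum_mul]

theorem fnormSq_add (X Y : Matrix α β ℝ) :
    fnormSq (X + Y) = fnormSq X + 2 * finner X Y + fnormSq Y := by
  simp only [fnormSq_eq_sum, finner_eq_sum, Finset.mul_sum, ← Finset.sum_add_distrib,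
    Matrix.add_apply]
  exact Finset.sum_congr rfl fun i _ => Finset.sum_congr rfl fun j _ => by ring

theorem fnormSq_smul (c : ℝ) (X : Matrix α β ℝ) : fnormSq (c • X) = c ^ 2 * fnormSq X := by
  rw [fnormSq, fnormSq, finner_smul_left, finner_smul_right]
  ring

theorem fnormSq_sub_comm (X Y : Matrix α β ℝ) :
    fnormSq (X - Y) = fnormSq (Y - X) := by
  rw [← neg_sub, ← neg_one_smul ℝ, fnormSq_smul]
  norm_num

theorem finner_mul_mul (Y : Matrix α δ ℝ) (H : Matrix α β ℝ) (V : Matrix β γ ℝ)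
    (A : Matrix γ δ ℝ) : finner Y (H * V * A) = finner (Hᵀ * Y * Aᵀ) V := by
  simp only [finner, Matrix.transpose_mul, Matrix.transpose_transpose]
  rw [← Matrix.mul_assoc, Matrix.trace_mul_comm, Matrix.mul_assoc, Matrix.mul_assoc]

/-- A quadratic function minimized at `X` has vanishing linear part there. -/
theorem eq_zero_of_quadratic_nonneg {G : Matrix α β ℝ} {Q : Matrix α β ℝ → ℝ}
    (hQ : ∀ (c : ℝ) V, Q (c • V) = c ^ 2 * Q V) (h : ∀ V, 0 ≤ finner G V + Q V) : G = 0 := by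
  refine eq_zero_of_fnormSq_eq_zero ?_
  have h1 : ∀ c : ℝ, 0 ≤ c * fnormSq G + c ^ 2 * Q G := fun c => by
    have := h (c • G)
    rwa [finner_smul_right, hQ] at this
  have hN := fnormSq_nonneg G
  set a := fnormSq G
  set b := Q G
  by_contra hne
  have ha : 0 < a := lt_of_le_of_ne hN (Ne.symm hne)
  have h2 := h1 (-(a / (|b| + a)))
  have hb : 0 < |b| + a := by positivity
  have h3 : (-(a / (|b| + a))) * a + (-(a / (|b| + a))) ^ 2 * b =
      (a / (|b| + a)) ^ 2 * (b - (|b| + a)) := by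
    field_simp
    ring
  rw [h3] at h2
  have : b - (|b| + a) < 0 := by linarith [le_abs_self b]
  nlinarith [mul_pos_of_neg_of_neg this (neg_neg_of_pos (pow_pos (div_pos ha hb) 2))]

end Frobenius

section MTLELM

variable {m L r d : ℕ} {Nt : Fin m → ℕ}

/-- The entries of a pair `(U, A)` as a single vector. -/
def entries (U : Matrix (Fin L) (Fin r) ℝ) (A : Fin m → Matrix (Fin r) (Fin d) ℝ) :
    (Fin L × Fin r) ⊕ (Fin m × Fin r × Fin d) → ℝ :=
  Sum.elim (fun p => U p.1 p.2) fun p => A p.1 p.2.1 p.2.2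

theorem exists_eval_entries_eq (H : ∀ t, Matrix (Fin (Nt t)) (Fin L) ℝ)
    (T : ∀ t, Matrix (Fin (Nt t)) (Fin d) ℝ) (μ1 μ2 : ℝ) :
    ∃ P : MvPolynomial ((Fin L × Fin r) ⊕ (Fin m × Fin r × Fin d)) ℝ, ∀ U A,
      MvPolynomial.eval (entries U A) P = (∑ t, (1 / 2) * fnormSq (H t * U * A t - T t))
        + (μ1 / 2) * fnormSq U + (μ2 / 2) * ∑ t, fnormSq (A t) := by
  refine ⟨(∑ t, MvPolynomial.C (1 / 2) * ∑ i, ∑ j, ((∑ b, (∑ a, MvPolynomial.C (H t i a) *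
      MvPolynomial.X (Sum.inl (a, b))) * MvPolynomial.X (Sum.inr (t, b, j))) -
        MvPolynomial.C (T t i j)) ^ 2) +
    MvPolynomial.C (μ1 / 2) * ∑ a, ∑ b, MvPolynomial.X (Sum.inl (a, b)) ^ 2 +
    MvPolynomial.C (μ2 / 2) * ∑ t, ∑ b, ∑ j, MvPolynomial.X (Sum.inr (t, b, j)) ^ 2,
    fun U A => ?_⟩
  simp [fnormSq_eq_sum, Matrix.mul_apply, entries]

theorem fnormSq_residual_add_left {n : ℕ} (H : Matrix (Fin n) (Fin L) ℝ)
    (T : Matrix (Fin n) (Fin d) ℝ) (U V : Matrix (Fin L) (Fin r) ℝ) (A : Matrix (Fin r) (Fin d) ℝ) :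
    fnormSq (H * (U + V) * A - T) = fnormSq (H * U * A - T) +
      2 * finner (Hᵀ * (H * U * A - T) * Aᵀ) V + fnormSq (H * V * A) := by
  rw [← finner_mul_mul, ← fnormSq_add]
  congr 1
  rw [Matrix.mul_add, Matrix.add_mul]
  abel

theorem fnormSq_residual_add_right {n : ℕ} (H : Matrix (Fin n) (Fin L) ℝ)
    (T : Matrix (Fin n) (Fin d) ℝ) (U : Matrix (Fin L) (Fin r) ℝ) (A B : Matrix (Fin r) (Fin d) ℝ) :
    fnormSq (H * U * (A + B) - T) = fnormSq (H * U * A - T) +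
      2 * finner (Uᵀ * Hᵀ * (H * U * A - T)) B + fnormSq (H * U * B) := by
  have h := finner_mul_mul (H * U * A - T) (H * U) B (1 : Matrix (Fin d) (Fin d) ℝ)
  rw [Matrix.mul_one, Matrix.transpose_one, Matrix.mul_one, Matrix.transpose_mul] at h
  rw [← h, ← fnormSq_add]
  congr 1
  rw [Matrix.mul_add]
  abel

/-- First-order condition and quadratic growth for the `U`-step. -/
theorem foc_left {H : ∀ t, Matrix (Fin (Nt t)) (Fin L) ℝ} {T : ∀ t, Matrix (Fin (Nt t)) (Fin d) ℝ}
    {μ : ℝ} {U : Matrix (Fin L) (Fin r) ℝ} {A : Fin m → Matrix (Fin r) (Fin d) ℝ}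
    (h : ∀ V : Matrix (Fin L) (Fin r) ℝ,
      (∑ t, (1 / 2) * fnormSq (H t * U * A t - T t)) + (μ / 2) * fnormSq U ≤
      (∑ t, (1 / 2) * fnormSq (H t * V * A t - T t)) + (μ / 2) * fnormSq V) :
    (∑ t, (H t)ᵀ * (H t * U * A t - T t) * (A t)ᵀ) + μ • U = 0 ∧
    ∀ V : Matrix (Fin L) (Fin r) ℝ,
      (∑ t, (1 / 2) * fnormSq (H t * U * A t - T t)) + (μ / 2) * fnormSq U +
        (μ / 2) * fnormSq V ≤
      (∑ t, (1 / 2) * fnormSq (H t * (U + V) * A t - T t)) + (μ / 2) * fnormSq (U + V) := by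
  set G := (∑ t, (H t)ᵀ * (H t * U * A t - T t) * (A t)ᵀ) + μ • U with hG
  let Q : Matrix (Fin L) (Fin r) ℝ → ℝ := fun V =>
    (∑ t, (1 / 2) * fnormSq (H t * V * A t)) + (μ / 2) * fnormSq V
  have hexp : ∀ V, (∑ t, (1 / 2) * fnormSq (H t * (U + V) * A t - T t)) +
      (μ / 2) * fnormSq (U + V) =
      (∑ t, (1 / 2) * fnormSq (H t * U * A t - T t)) + (μ / 2) * fnormSq U +
        (finner G V + Q V) := by
    intro V
    simp only [hG, Q, fnormSq_residual_add_left, fnormSq_add, finner_add_left, finner_sum_left,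
      finner_smul_left, mul_add, Finset.sum_add_distrib, ← mul_assoc]
    norm_num
    ring
  have hG0 : G = 0 := by
    refine eq_zero_of_quadratic_nonneg (Q := Q) (fun c V => ?_) fun V => ?_
    · simp only [Q, Matrix.mul_smul, Matrix.smul_mul, fnormSq_smul, mul_add, Finset.mul_sum]
      congr 1
      · exact Finset.sum_congr rfl fun t _ => by ring
      · ring
    · have := h (U + V)
      rw [hexp] at this
      linarith
  refine ⟨hG0, fun V => ?_⟩
  rw [hexp, hG0, finner_zero_left, zero_add]
  have : 0 ≤ ∑ t, (1 / 2) * fnormSq (H t * V * A t) :=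
    Finset.sum_nonneg fun t _ => mul_nonneg (by norm_num) (fnormSq_nonneg _)
  simp only [Q]
  linarith

/-- First-order condition and quadratic growth for the `A_t`-step. -/
theorem foc_right {n : ℕ} {H : Matrix (Fin n) (Fin L) ℝ} {T : Matrix (Fin n) (Fin d) ℝ}
    {μ : ℝ} {U : Matrix (Fin L) (Fin r) ℝ} {A : Matrix (Fin r) (Fin d) ℝ}
    (h : ∀ B : Matrix (Fin r) (Fin d) ℝ,
      (1 / 2) * fnormSq (H * U * A - T) + (μ / 2) * fnormSq A ≤
      (1 / 2) * fnormSq (H * U * B - T) + (μ / 2) * fnormSq B) :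
    Uᵀ * Hᵀ * (H * U * A - T) + μ • A = 0 ∧
    ∀ B : Matrix (Fin r) (Fin d) ℝ,
      (1 / 2) * fnormSq (H * U * A - T) + (μ / 2) * fnormSq A + (μ / 2) * fnormSq B ≤
      (1 / 2) * fnormSq (H * U * (A + B) - T) + (μ / 2) * fnormSq (A + B) := by
  set G := Uᵀ * Hᵀ * (H * U * A - T) + μ • A with hG
  let Q : Matrix (Fin r) (Fin d) ℝ → ℝ := fun B =>
    (1 / 2) * fnormSq (H * U * B) + (μ / 2) * fnormSq B
  have hexp : ∀ B, (1 / 2) * fnormSq (H * U * (A + B) - T) + (μ / 2) * fnormSq (A + B) =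
      (1 / 2) * fnormSq (H * U * A - T) + (μ / 2) * fnormSq A + (finner G B + Q B) := by
    intro B
    simp only [hG, Q, fnormSq_residual_add_right, fnormSq_add, finner_add_left, finner_smul_left]
    ring
  have hG0 : G = 0 := by
    refine eq_zero_of_quadratic_nonneg (Q := Q) (fun c B => ?_) fun B => ?_
    · simp only [Q, Matrix.mul_smul, fnormSq_smul]
      ring
    · have := h (A + B)
      rw [hexp] at this
      linarith
  refine ⟨hG0, fun B => ?_⟩
  rw [hexp, hG0, finner_zero_left, zero_add]
  have := fnormSq_nonneg (H * U * B)
  simp only [Q]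
  linarith

theorem exists_entries_eq_update_inl (U : Matrix (Fin L) (Fin r) ℝ)
    (A : Fin m → Matrix (Fin r) (Fin d) ℝ) (p : Fin L × Fin r) (s : ℝ) :
    ∃ V, entries V A = Function.update (entries U A) (Sum.inl p) s := by
  refine ⟨fun a b => Function.update (entries U A) (Sum.inl p) s (Sum.inl (a, b)), ?_⟩
  funext q
  rcases q with q | q <;> simp [entries]

theorem exists_entries_eq_update_inr (U : Matrix (Fin L) (Fin r) ℝ)
    (A : Fin m → Matrix (Fin r) (Fin d) ℝ) (p : Fin m × Fin r × Fin d) (s : ℝ) :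
    ∃ B, entries U B = Function.update (entries U A) (Sum.inr p) s := by
  refine ⟨fun t b j => Function.update (entries U A) (Sum.inr p) s (Sum.inr (t, b, j)), ?_⟩
  funext q
  rcases q with q | q <;> simp [entries]

theorem abs_entries_sub_le {U U' : Matrix (Fin L) (Fin r) ℝ}
    {A A' : Fin m → Matrix (Fin r) (Fin d) ℝ} {D : ℝ}
    (h : fnormSq (U - U') + ∑ t, fnormSq (A t - A' t) ≤ D) (i) :
    |entries U A i - entries U' A' i| ≤ √D := by
  have h1 := fnormSq_nonneg (U - U')
  have h2 : ∀ t ∈ Finset.univ, 0 ≤ fnormSq (A t - A' t) := fun t _ => fnormSq_nonneg _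
  refine Real.abs_le_sqrt ?_
  rcases i with ⟨a, b⟩ | ⟨t, b, j⟩
  · have := sq_apply_le_fnormSq (U - U') a b
    have := Finset.sum_nonneg h2
    simp only [entries, Sum.elim_inl, Matrix.sub_apply] at *
    linarith
  · have := sq_apply_le_fnormSq (A t - A' t) b j
    have := Finset.single_le_sum h2 (Finset.mem_univ t)
    simp only [entries, Sum.elim_inr, Matrix.sub_apply] at *
    linarith

end MTLELM

/-- Lemma 1: the sequence `(U^k, A^k)` generated by the MTL-ELM
alternating exact-minimization algorithm converges to a stationary point `(U*, A*)`
of the objective `J`, i.e. a point where the gradient of `J` vanishes. -/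
theorem stmt18 (m L r d : ℕ) (Nt : Fin m → ℕ)
    (H : ∀ t, Matrix (Fin (Nt t)) (Fin L) ℝ)
    (T : ∀ t, Matrix (Fin (Nt t)) (Fin d) ℝ)
    (μ1 μ2 : ℝ) (hμ1 : 0 < μ1) (hμ2 : 0 < μ2)
    (J : Matrix (Fin L) (Fin r) ℝ → (Fin m → Matrix (Fin r) (Fin d) ℝ) → ℝ)
    (hJ : ∀ U A, J U A = (∑ t, (1 / 2) * fnormSq (H t * U * A t - T t))
        + (μ1 / 2) * fnormSq U + (μ2 / 2) * ∑ t, fnormSq (A t))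
    (U : ℕ → Matrix (Fin L) (Fin r) ℝ)
    (A : ℕ → Fin m → Matrix (Fin r) (Fin d) ℝ)
    -- `U^(k+1)` exactly minimizes `J(·, A^k)`
    (hU : ∀ (k : ℕ) (V : Matrix (Fin L) (Fin r) ℝ), J (U (k + 1)) (A k) ≤ J V (A k))
    -- `A_t^(k+1)` exactly minimizes `½‖H_t U^(k+1) A − T_t‖² + (μ2/2)‖A‖²`
    (hA : ∀ (k : ℕ) (t : Fin m) (B : Matrix (Fin r) (Fin d) ℝ),
      (1 / 2) * fnormSq (H t * U (k + 1) * A (k + 1) t - T t)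
          + (μ2 / 2) * fnormSq (A (k + 1) t)
      ≤ (1 / 2) * fnormSq (H t * U (k + 1) * B - T t) + (μ2 / 2) * fnormSq B) :
    ∃ (Us : Matrix (Fin L) (Fin r) ℝ) (As : Fin m → Matrix (Fin r) (Fin d) ℝ),
      Tendsto U atTop (𝓝 Us) ∧
      (∀ t, Tendsto (fun k : ℕ => A k t) atTop (𝓝 (As t))) ∧
      -- the gradient of `J` vanishes at `(U*, A*)`:
      (∑ t, (H t)ᵀ * (H t * Us * As t - T t) * (As t)ᵀ) + μ1 • Us = 0 ∧
      (∀ t, Usᵀ * (H t)ᵀ * (H t * Us * As t - T t) + μ2 • As t = 0) := by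
  have hUstep := fun k => foc_left (H := H) (T := T) (μ := μ1) (U := U (k + 1)) (A := A k)
    fun V => by
      have := hU k V
      rw [hJ, hJ] at this
      linarith
  have hAstep := fun k t => foc_right (hA k t)
  have hAmin : ∀ k B, J (U (k + 1)) (A (k + 1)) + (μ2 / 2) * ∑ t, fnormSq (B t - A (k + 1) t) ≤
      J (U (k + 1)) B := by
    intro k B
    have := Finset.sum_le_sum fun t (_ : t ∈ Finset.univ) => (hAstep k t).2 (B t - A (k + 1) t)
    simp only [add_sub_cancel, Finset.sum_add_distrib, ← Finset.mul_sum] at this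
    rw [hJ, hJ, ← Finset.mul_sum, ← Finset.mul_sum]
    linarith
  have hUmin : ∀ k V, J (U (k + 1)) (A k) + (μ1 / 2) * fnormSq (V - U (k + 1)) ≤ J V (A k) := by
    intro k V
    have := (hUstep k).2 (V - U (k + 1))
    rw [add_sub_cancel] at this
    rw [hJ, hJ]
    linarith
  set D : ℕ → ℝ := fun k => fnormSq (U (k + 1) - U k) + ∑ t, fnormSq (A (k + 1) t - A k t) with hD
  have hsumA : ∀ B : Fin m → Matrix (Fin r) (Fin d) ℝ, 0 ≤ ∑ t, fnormSq (B t) :=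
    fun B => Finset.sum_nonneg fun t _ => fnormSq_nonneg _
  have hD0 : ∀ k, 0 ≤ D k := fun k =>
    add_nonneg (fnormSq_nonneg _) (hsumA fun t => A (k + 1) t - A k t)
  set c := min μ1 μ2 / 2 with hc
  have hc0 : 0 < c := half_pos (lt_min hμ1 hμ2)
  have hc1 : c ≤ μ1 / 2 := by rw [hc]; gcongr; exact min_le_left _ _
  have hc2 : c ≤ μ2 / 2 := by rw [hc]; gcongr; exact min_le_right _ _
  have hmid : ∀ k, J (U (k + 1)) (A k) ≤ J (U k) (A k) := fun k => hU k _
  have hdec : ∀ k, c * D k ≤ J (U k) (A k) - J (U (k + 1)) (A (k + 1)) := by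
    intro k
    have h1 := hUmin k (U k)
    have h2 := hAmin k (A k)
    rw [fnormSq_sub_comm] at h1
    simp only [fnormSq_sub_comm (A k _)] at h2
    have h3 := mul_le_mul_of_nonneg_right hc1 (fnormSq_nonneg (U (k + 1) - U k))
    have h4 := mul_le_mul_of_nonneg_right hc2 (hsumA fun t => A (k + 1) t - A k t)
    rw [hD, mul_add]
    linarith
  have hcoer : ∀ V B, c * (fnormSq V + ∑ t, fnormSq (B t)) ≤ J V B := by
    intro V B
    rw [hJ, mul_add]
    have h3 := mul_le_mul_of_nonneg_right hc1 (fnormSq_nonneg V)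
    have h4 := mul_le_mul_of_nonneg_right hc2 (hsumA B)
    have h5 : 0 ≤ ∑ t, (1 / 2) * fnormSq (H t * V * B t - T t) :=
      Finset.sum_nonneg fun t _ => mul_nonneg (by norm_num) (fnormSq_nonneg _)
    linarith
  have hJ0 : ∀ k, J (U k) (A k) ≤ J (U 0) (A 0) := fun k =>
    antitone_nat_of_succ_le (f := fun k => J (U k) (A k))
      (fun k => by linarith [hdec k, mul_nonneg hc0.le (hD0 k)]) (Nat.zero_le k)
  have hbound : ∀ V B, J V B ≤ J (U 0) (A 0) → ∀ i, |entries V B i| ≤ √(J (U 0) (A 0) / c) := by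
    intro V B h i
    have := abs_entries_sub_le (U := V) (U' := 0) (A := B) (A' := 0)
      (D := J (U 0) (A 0) / c) (by
        rw [le_div_iff₀' hc0]
        simpa using (hcoer V B).trans h) i
    rcases i with i | i <;> simpa [entries] using this
  obtain ⟨P, hP⟩ := exists_eval_entries_eq H T μ1 μ2
  have hPJ : ∀ V B, MvPolynomial.eval (entries V B) P = J V B := fun V B => by rw [hP, hJ]
  obtain ⟨x, hx⟩ := P.exists_tendsto_of_descent (z := fun k => entries (U k) (A k))
    (w := fun k => entries (U (k + 1)) (A k)) (D := fun k => √(D k)) (c := c)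
    (R := √(J (U 0) (A 0) / c)) hc0
    (fun k => hbound _ _ (hJ0 k)) (fun k => hbound _ _ ((hmid k).trans (hJ0 k)))
    (fun k => Real.sqrt_nonneg _) (fun k => abs_entries_sub_le le_rfl)
    (fun k => abs_entries_sub_le (by
      rw [hD, sub_self]
      simpa [fnormSq, finner] using fnormSq_nonneg (U (k + 1) - U k)))
    (fun k i => by
      rcases i with p | p
      · refine Or.inl (MvPolynomial.eval_pderiv_eq_zero_of_forall_le fun s => ?_)
        obtain ⟨V, hV⟩ := exists_entries_eq_update_inl (U (k + 1)) (A k) p s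
        rw [← hV, hPJ, hPJ]
        exact hU k V
      · refine Or.inr (MvPolynomial.eval_pderiv_eq_zero_of_forall_le fun s => ?_)
        obtain ⟨B, hB⟩ := exists_entries_eq_update_inr (U (k + 1)) (A (k + 1)) p s
        rw [← hB, hPJ, hPJ]
        have := mul_nonneg (half_pos hμ2).le (hsumA fun t => B t - A (k + 1) t)
        linarith [hAmin k B])
    (fun k => by
      rw [Real.sq_sqrt (hD0 k), hPJ, hPJ]
      exact hdec k)
    (fun k => by
      rw [hPJ]
      exact (mul_nonneg hc0.le (add_nonneg (fnormSq_nonneg _) (hsumA _))).trans (hcoer _ _))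
  rw [tendsto_pi_nhds] at hx
  let Us : Matrix (Fin L) (Fin r) ℝ := fun a b => x (Sum.inl (a, b))
  let As : Fin m → Matrix (Fin r) (Fin d) ℝ := fun t b j => x (Sum.inr (t, b, j))
  have hUs : Tendsto U atTop (𝓝 Us) :=
    tendsto_pi_nhds.2 fun a => tendsto_pi_nhds.2 fun b => hx (Sum.inl (a, b))
  have hAs : ∀ t, Tendsto (fun k => A k t) atTop (𝓝 (As t)) := fun t =>
    tendsto_pi_nhds.2 fun b => tendsto_pi_nhds.2 fun j => hx (Sum.inr (t, b, j))
  have hUs' := hUs.comp (tendsto_add_atTop_nat 1)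
  have hAs' := fun t => (hAs t).comp (tendsto_add_atTop_nat 1)
  refine ⟨Us, As, hUs, hAs, ?_, fun t => ?_⟩
  · have hcont : Continuous fun q : Matrix (Fin L) (Fin r) ℝ × (Fin m → Matrix (Fin r) (Fin d) ℝ) =>
        (∑ t, (H t)ᵀ * (H t * q.1 * q.2 t - T t) * (q.2 t)ᵀ) + μ1 • q.1 := by fun_prop
    have := (hcont.tendsto (Us, As)).comp (hUs'.prodMk_nhds (tendsto_pi_nhds.2 hAs))
    exact tendsto_nhds_unique this (tendsto_const_nhds.congr fun k => ((hUstep k).1).symm)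
  · have hcont : Continuous fun q : Matrix (Fin L) (Fin r) ℝ × Matrix (Fin r) (Fin d) ℝ =>
        q.1ᵀ * (H t)ᵀ * (H t * q.1 * q.2 - T t) + μ2 • q.2 := by fun_prop
    have := (hcont.tendsto (Us, As t)).comp (hUs'.prodMk_nhds (hAs' t))
    exact tendsto_nhds_unique this (tendsto_const_nhds.congr fun k => ((hAstep k t).1).symm)
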